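/- If E ⊆ H₃ is a 3-dimensional associative subspace invariant under the substitution action of R_{π/3}, then E equals one of A₁₂₃, A₁₄₅, A₁₆₇. -/

import Mathlib

noncomputable section

open MvPolynomial Matrix

/-- The polynomial ring `ℝ[x,y,z]`. -/
abbrev P3 := MvPolynomial (Fin 3) ℝ

/-- `SO(3)`, realised as a set of real 3×3 matrices. -/
def SO3 : Set (Matrix (Fin 3) (Fin 3) ℝ) := {A | A * Aᵀ = 1 ∧ A.det = 1}

/-- The substitution action of a matrix `A` on polynomials: `(A · p)(w) = p (A⁻¹ w)`,
i.e. the variable `Xᵢ` is replaced by `∑ⱼ (A⁻¹)ᵢⱼ Xⱼ`. -/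
def sAct (A : Matrix (Fin 3) (Fin 3) ℝ) (p : P3) : P3 :=
  aeval (fun i => ∑ j, A⁻¹ i j • (X j : P3)) p

/-- The Laplace operator on polynomials in three variables. -/
def lap : P3 →ₗ[ℝ] P3 :=
  ∑ i : Fin 3, ((pderiv i).toLinearMap ∘ₗ (pderiv i).toLinearMap)

/-- `H₃`: the space of harmonic homogeneous cubic polynomials in `x, y, z`. -/
def H3 : Submodule ℝ P3 :=
  homogeneousSubmodule (Fin 3) ℝ 3 ⊓ LinearMap.ker lap

/-- The orthonormal basis `e₁, …, e₇` of `H₃` (with `x = X 0`, `y = X 1`, `z = X 2`). -/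
def eH : Fin 7 → P3 :=
  ![(1 / 5 : ℝ) • (X 0 * (2 * X 0 ^ 2 - 3 * X 1 ^ 2 - 3 * X 2 ^ 2)),
    (Real.sqrt 6 / 10) • (X 2 * (4 * X 0 ^ 2 - X 1 ^ 2 - X 2 ^ 2)),
    (Real.sqrt 6 / 10) • (X 1 * (4 * X 0 ^ 2 - X 1 ^ 2 - X 2 ^ 2)),
    (2 * Real.sqrt 15 / 5) • (X 0 * X 1 * X 2),
    (Real.sqrt 15 / 5) • (X 0 * (X 1 ^ 2 - X 2 ^ 2)),
    (Real.sqrt 10 / 10) • (X 2 * (3 * X 1 ^ 2 - X 2 ^ 2)),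
    (Real.sqrt 10 / 10) • (X 1 * (X 1 ^ 2 - 3 * X 2 ^ 2))]

/-- The identification of `ℝ⁷` (coordinates) with `H₃`, via the basis `e₁, …, e₇`. -/
def iotaH (v : Fin 7 → ℝ) : P3 := ∑ i, v i • eH i

/-- The subset of `H₃` corresponding to a coordinate subspace `E ⊆ ℝ⁷`. -/
def polySet (E : Submodule ℝ (Fin 7 → ℝ)) : Set P3 := iotaH '' (E : Set (Fin 7 → ℝ))

/-- The inner product of `H₃` making `e₁, …, e₇` orthonormal, in coordinates. -/
def dot7 (u v : Fin 7 → ℝ) : ℝ := ∑ i, u i * v i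

/-- The 3×3 minor determinant `(eⁱ ∧ eʲ ∧ eᵏ) (u, v, w)`. -/
def triD (u v w : Fin 7 → ℝ) (i j k : Fin 7) : ℝ :=
  Matrix.det !![u i, u j, u k; v i, v j, v k; w i, w j, w k]

/-- The 3-form `φ₀ = e¹²³ + e¹⁴⁵ − e¹⁶⁷ + e²⁴⁶ + e²⁵⁷ + e³⁴⁷ − e³⁵⁶`, in coordinates
(indices shifted by one: `eᵢ = e (i-1)`). -/
def phi0 (u v w : Fin 7 → ℝ) : ℝ :=
  triD u v w 0 1 2 + triD u v w 0 3 4 - triD u v w 0 5 6 + triD u v w 1 3 5 +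
    triD u v w 1 4 6 + triD u v w 2 3 6 - triD u v w 2 4 5

/-- A 3-dimensional subspace `E` of `H₃` (in coordinates) is associative if it has an
orthonormal basis `(u, v, w)` with `φ₀ (u, v, w) = ±1`. -/
def IsAssocSubspace (E : Submodule ℝ (Fin 7 → ℝ)) : Prop :=
  ∃ u v w : Fin 7 → ℝ, u ∈ E ∧ v ∈ E ∧ w ∈ E ∧
    dot7 u u = 1 ∧ dot7 v v = 1 ∧ dot7 w w = 1 ∧
    dot7 u v = 0 ∧ dot7 u w = 0 ∧ dot7 v w = 0 ∧
    Submodule.span ℝ {u, v, w} = E ∧ (phi0 u v w = 1 ∨ phi0 u v w = -1)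

/-- The subspace `E ⊆ H₃` is invariant under the substitution action of `A`: `A · E = E`. -/
def InvUnder (A : Matrix (Fin 3) (Fin 3) ℝ) (E : Submodule ℝ (Fin 7 → ℝ)) : Prop :=
  sAct A '' polySet E = polySet E

/-- The `SO(3)`-stabiliser of a subspace `E ⊆ H₃`: `{A ∈ SO(3) | A · E = E}`. -/
def stabSO3 (E : Submodule ℝ (Fin 7 → ℝ)) : Set (Matrix (Fin 3) (Fin 3) ℝ) :=
  {A | A ∈ SO3 ∧ InvUnder A E}

/-- The subset `S` of a monoid is a subgroup isomorphic to the group `G`. -/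
def SetIsoGroup {M : Type*} [Monoid M] (S : Set M) (G : Type*) [Group G] : Prop :=
  ∃ f : G → M, Function.Injective f ∧ (∀ a b, f (a * b) = f a * f b) ∧ Set.range f = S

/-- The rotation `R_α` about the x-axis through the angle `α`. -/
def Rmat (α : ℝ) : Matrix (Fin 3) (Fin 3) ℝ :=
  !![1, 0, 0; 0, Real.cos α, -Real.sin α; 0, Real.sin α, Real.cos α]

/-- `A₁₂₃ = span (e₁, e₂, e₃)`, in coordinates. -/
def A123 : Submodule ℝ (Fin 7 → ℝ) :=
  Submodule.span ℝ {![1, 0, 0, 0, 0, 0, 0], ![0, 1, 0, 0, 0, 0, 0], ![0, 0, 1, 0, 0, 0, 0]}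

/-- `A₁₄₅ = span (e₁, e₄, e₅)`, in coordinates. -/
def A145 : Submodule ℝ (Fin 7 → ℝ) :=
  Submodule.span ℝ {![1, 0, 0, 0, 0, 0, 0], ![0, 0, 0, 1, 0, 0, 0], ![0, 0, 0, 0, 1, 0, 0]}

/-- `A₁₆₇ = span (e₁, e₆, e₇)`, in coordinates. -/
def A167 : Submodule ℝ (Fin 7 → ℝ) :=
  Submodule.span ℝ {![1, 0, 0, 0, 0, 0, 0], ![0, 0, 0, 0, 0, 1, 0], ![0, 0, 0, 0, 0, 0, 1]}

/-- The action of `R_{π/3}` on `H₃` in the coordinates given by `e₁, …, e₇`. -/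
def rotCoord (v : Fin 7 → ℝ) : Fin 7 → ℝ :=
  ![v 0, 1 / 2 * v 1 + √3 / 2 * v 2, -(√3 / 2) * v 1 + 1 / 2 * v 2,
    -(1 / 2) * v 3 + √3 / 2 * v 4, -(√3 / 2) * v 3 - 1 / 2 * v 4, -v 5, -v 6]

lemma sqrt_three_sq : √3 ^ 2 = (3 : ℝ) := Real.sq_sqrt (by norm_num)

lemma Rmat_inv (α : ℝ) : (Rmat α)⁻¹ = (Rmat α)ᵀ := by
  refine Matrix.inv_eq_right_inv ?_
  have h := Real.sin_sq_add_cos_sq α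
  ext i j
  fin_cases i <;> fin_cases j <;>
    simp [Rmat, Matrix.mul_apply, Fin.sum_univ_three] <;> linarith

lemma eval_iotaH (v : Fin 7 → ℝ) (w : Fin 3 → ℝ) :
    eval w (iotaH v) =
      v 0 * (1 / 5 * (w 0 * (2 * w 0 ^ 2 - 3 * w 1 ^ 2 - 3 * w 2 ^ 2))) +
      v 1 * (√6 / 10 * (w 2 * (4 * w 0 ^ 2 - w 1 ^ 2 - w 2 ^ 2))) +
      v 2 * (√6 / 10 * (w 1 * (4 * w 0 ^ 2 - w 1 ^ 2 - w 2 ^ 2))) +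
      v 3 * (2 * √15 / 5 * (w 0 * w 1 * w 2)) +
      v 4 * (√15 / 5 * (w 0 * (w 1 ^ 2 - w 2 ^ 2))) +
      v 5 * (√10 / 10 * (w 2 * (3 * w 1 ^ 2 - w 2 ^ 2))) +
      v 6 * (√10 / 10 * (w 1 * (w 1 ^ 2 - 3 * w 2 ^ 2))) := by
  have h2 : eval w (2 : P3) = 2 := map_ofNat _ _
  have h3 : eval w (3 : P3) = 3 := map_ofNat _ _
  have h4 : eval w (4 : P3) = 4 := map_ofNat _ _
  simp [iotaH, eH, Fin.sum_univ_seven, smul_eval, h2, h3, h4]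

lemma iotaH_injective : Function.Injective iotaH := by
  intro u v h
  have key : ∀ a b c : ℝ, eval ![a, b, c] (iotaH u) = eval ![a, b, c] (iotaH v) :=
    fun _ _ _ => by rw [h]
  simp only [eval_iotaH, Matrix.cons_val] at key
  have k1 := key 1 0 0
  have k2 := key 0 0 1
  have k3 := key 0 1 0
  have k4 := key 1 0 1
  have k5 := key 1 1 0
  have k6 := key 1 1 1
  have k7 := key (-1) 1 0
  have h6 : √6 ≠ 0 := by positivity
  have h10 : √10 ≠ 0 := by positivity
  have h15 : √15 ≠ 0 := by positivity
  ring_nf at k1 k2 k3 k4 k5 k6 k7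
  have e0 : u 0 = v 0 := by linarith
  have e1 : u 1 = v 1 := mul_right_cancel₀ h6 (by linarith)
  have e2 : u 2 = v 2 := mul_right_cancel₀ h6 (by linarith)
  have e5 : u 5 = v 5 := mul_right_cancel₀ h10 (by rw [e1] at k2; linarith)
  have e6 : u 6 = v 6 := mul_right_cancel₀ h10 (by rw [e2] at k3; linarith)
  rw [e0, e1, e2, e5, e6] at k6
  have e4 : u 4 = v 4 := mul_right_cancel₀ h15 (by linarith)
  have e3 : u 3 = v 3 := mul_right_cancel₀ h15 (by linarith)
  ext i
  fin_cases i <;> assumption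

lemma sAct_iotaH (v : Fin 7 → ℝ) :
    sAct (Rmat (Real.pi / 3)) (iotaH v) = iotaH (rotCoord v) := by
  refine MvPolynomial.funext fun w => ?_
  have hcomp : eval w (sAct (Rmat (Real.pi / 3)) (iotaH v)) =
      eval (fun i => ∑ j, (Rmat (Real.pi / 3))⁻¹ i j * w j) (iotaH v) := by
    rw [sAct, map_aeval]
    simp only [map_sum, smul_eval, eval_X]
    refine congrArg (fun f => eval₂Hom f _ (iotaH v)) ?_
    ext r
    simp
  rw [hcomp, Rmat_inv, eval_iotaH, eval_iotaH]
  simp [Rmat, Fin.sum_univ_three, rotCoord]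
  have h3 : √3 ^ 3 = 3 * √3 := by rw [pow_succ, sqrt_three_sq]
  ring_nf
  simp only [sqrt_three_sq, h3]
  ring

lemma rotCoord_mem {E : Submodule ℝ (Fin 7 → ℝ)}
    (hinv : InvUnder (Rmat (Real.pi / 3)) E) {v : Fin 7 → ℝ} (hv : v ∈ E) :
    rotCoord v ∈ E := by
  have h : sAct (Rmat (Real.pi / 3)) (iotaH v) ∈ polySet E :=
    hinv ▸ Set.mem_image_of_mem _ (Set.mem_image_of_mem _ hv)
  obtain ⟨u, hu, huv⟩ := h
  rw [sAct_iotaH] at huv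
  exact iotaH_injective huv ▸ hu

lemma rotCoord_cube (v : Fin 7 → ℝ) :
    rotCoord (rotCoord (rotCoord v)) = ![v 0, -v 1, -v 2, v 3, v 4, -v 5, -v 6] := by
  have h3 : √3 ^ 3 = 3 * √3 := by rw [pow_succ, sqrt_three_sq]
  ext i
  fin_cases i <;> simp [rotCoord] <;> ring_nf <;> simp only [sqrt_three_sq, h3] <;> ring

lemma even_part_mem {E : Submodule ℝ (Fin 7 → ℝ)} (hE : ∀ v ∈ E, rotCoord v ∈ E)
    {v : Fin 7 → ℝ} (hv : v ∈ E) : ![v 0, 0, 0, v 3, v 4, 0, 0] ∈ E := by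
  have h := E.smul_mem (1 / 2) (E.add_mem hv (hE _ (hE _ (hE _ hv))))
  rw [rotCoord_cube] at h
  convert h using 1
  ext i
  fin_cases i <;> simp [-Matrix.add_cons] <;> ring

lemma proj_zero_mem {E : Submodule ℝ (Fin 7 → ℝ)} (hE : ∀ v ∈ E, rotCoord v ∈ E)
    {v : Fin 7 → ℝ} (hv : v ∈ E) : ![v 0, 0, 0, 0, 0, 0, 0] ∈ E := by
  have hx := even_part_mem hE hv
  have h := E.smul_mem (1 / 3) (E.add_mem hx (E.add_mem (hE _ hx) (hE _ (hE _ hx))))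
  convert h using 1
  ext i
  fin_cases i <;> simp [rotCoord] <;> ring_nf <;> simp only [sqrt_three_sq] <;> ring

lemma proj_three_four_mem {E : Submodule ℝ (Fin 7 → ℝ)} (hE : ∀ v ∈ E, rotCoord v ∈ E)
    {v : Fin 7 → ℝ} (hv : v ∈ E) : ![0, 0, 0, v 3, v 4, 0, 0] ∈ E := by
  convert E.sub_mem (even_part_mem hE hv) (proj_zero_mem hE hv) using 1
  ext i
  fin_cases i <;> simp

lemma odd_part_mem {E : Submodule ℝ (Fin 7 → ℝ)} (hE : ∀ v ∈ E, rotCoord v ∈ E)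
    {v : Fin 7 → ℝ} (hv : v ∈ E) : ![0, v 1, v 2, 0, 0, v 5, v 6] ∈ E := by
  convert E.sub_mem hv (even_part_mem hE hv) using 1
  ext i
  fin_cases i <;> simp [-Matrix.sub_cons]

lemma proj_one_two_mem {E : Submodule ℝ (Fin 7 → ℝ)} (hE : ∀ v ∈ E, rotCoord v ∈ E)
    {v : Fin 7 → ℝ} (hv : v ∈ E) : ![0, v 1, v 2, 0, 0, 0, 0] ∈ E := by
  have hy := odd_part_mem hE hv
  have h := E.smul_mem (1 / 3)
    (E.add_mem (E.sub_mem (hE _ (hE _ hy)) (hE _ hy)) hy)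
  convert E.sub_mem hy h using 1
  ext i
  fin_cases i <;> simp [rotCoord] <;> ring_nf <;> simp only [sqrt_three_sq] <;> ring

lemma quarter_turn_one_two_mem {E : Submodule ℝ (Fin 7 → ℝ)} (hE : ∀ v ∈ E, rotCoord v ∈ E)
    {v : Fin 7 → ℝ} (hv : v ∈ E) : ![0, v 2, -v 1, 0, 0, 0, 0] ∈ E := by
  have hp := proj_one_two_mem hE hv
  have h := E.smul_mem (1 / √3) (E.sub_mem (E.smul_mem 2 (hE _ hp)) hp)
  have h3 : √3 ≠ 0 := by positivity
  convert h using 1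
  ext i
  fin_cases i <;> simp [rotCoord] <;> field_simp <;> ring

lemma quarter_turn_three_four_mem {E : Submodule ℝ (Fin 7 → ℝ)} (hE : ∀ v ∈ E, rotCoord v ∈ E)
    {v : Fin 7 → ℝ} (hv : v ∈ E) : ![0, 0, 0, v 4, -v 3, 0, 0] ∈ E := by
  have hp := proj_three_four_mem hE hv
  have h := E.smul_mem (1 / √3) (E.add_mem (E.smul_mem 2 (hE _ hp)) hp)
  have h3 : √3 ≠ 0 := by positivity
  convert h using 1
  ext i
  fin_cases i <;> simp [rotCoord] <;> field_simp <;> ring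

lemma zero_dichotomy {E : Submodule ℝ (Fin 7 → ℝ)} (hE : ∀ v ∈ E, rotCoord v ∈ E) :
    (![1, 0, 0, 0, 0, 0, 0] : Fin 7 → ℝ) ∈ E ∨ ∀ v ∈ E, v 0 = 0 := by
  refine or_iff_not_imp_right.2 fun h => ?_
  push Not at h
  obtain ⟨v, hv, h0⟩ := h
  convert E.smul_mem (v 0)⁻¹ (proj_zero_mem hE hv) using 1
  ext i
  fin_cases i <;> simp [h0]

lemma one_two_dichotomy {E : Submodule ℝ (Fin 7 → ℝ)} (hE : ∀ v ∈ E, rotCoord v ∈ E) :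
    ((![0, 1, 0, 0, 0, 0, 0] : Fin 7 → ℝ) ∈ E ∧ (![0, 0, 1, 0, 0, 0, 0] : Fin 7 → ℝ) ∈ E) ∨
      ∀ v ∈ E, v 1 = 0 ∧ v 2 = 0 := by
  refine or_iff_not_imp_right.2 fun h => ?_
  push Not at h
  obtain ⟨v, hv, h0⟩ := h
  have hs : v 1 ^ 2 + v 2 ^ 2 ≠ 0 := fun hs => h0 (by nlinarith) (by nlinarith)
  have hp := proj_one_two_mem hE hv
  have hq := quarter_turn_one_two_mem hE hv
  constructor
  · convert E.smul_mem (v 1 ^ 2 + v 2 ^ 2)⁻¹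
      (E.add_mem (E.smul_mem (v 1) hp) (E.smul_mem (v 2) hq)) using 1
    ext i
    fin_cases i <;> simp <;> field_simp
    simp
  · convert E.smul_mem (v 1 ^ 2 + v 2 ^ 2)⁻¹
      (E.sub_mem (E.smul_mem (v 2) hp) (E.smul_mem (v 1) hq)) using 1
    ext i
    fin_cases i <;> simp <;> field_simp
    · simp
    · ring

lemma three_four_dichotomy {E : Submodule ℝ (Fin 7 → ℝ)} (hE : ∀ v ∈ E, rotCoord v ∈ E) :
    ((![0, 0, 0, 1, 0, 0, 0] : Fin 7 → ℝ) ∈ E ∧ (![0, 0, 0, 0, 1, 0, 0] : Fin 7 → ℝ) ∈ E) ∨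
      ∀ v ∈ E, v 3 = 0 ∧ v 4 = 0 := by
  refine or_iff_not_imp_right.2 fun h => ?_
  push Not at h
  obtain ⟨v, hv, h0⟩ := h
  have hs : v 3 ^ 2 + v 4 ^ 2 ≠ 0 := fun hs => h0 (by nlinarith) (by nlinarith)
  have hp := proj_three_four_mem hE hv
  have hq := quarter_turn_three_four_mem hE hv
  constructor
  · convert E.smul_mem (v 3 ^ 2 + v 4 ^ 2)⁻¹
      (E.add_mem (E.smul_mem (v 3) hp) (E.smul_mem (v 4) hq)) using 1
    ext i
    fin_cases i <;> simp <;> field_simp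
    simp
  · convert E.smul_mem (v 3 ^ 2 + v 4 ^ 2)⁻¹
      (E.sub_mem (E.smul_mem (v 4) hp) (E.smul_mem (v 3) hq)) using 1
    ext i
    fin_cases i <;> simp <;> field_simp
    · simp
    · ring

lemma finrank_span_triple {u v w : Fin 7 → ℝ} (h : LinearIndependent ℝ ![u, v, w]) :
    Module.finrank ℝ (Submodule.span ℝ {u, v, w}) = 3 := by
  have hr : Set.range ![u, v, w] = {u, v, w} := by
    rw [Matrix.range_cons, Matrix.range_cons_cons_empty]
    rfl
  rw [← hr, finrank_span_eq_card h, Fintype.card_fin]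

lemma finrank_A123 : Module.finrank ℝ A123 = 3 := by
  refine finrank_span_triple (Fintype.linearIndependent_iff.2 fun g hg => ?_)
  have h0 := congrFun hg 0
  have h1 := congrFun hg 1
  have h2 := congrFun hg 2
  simp [Fin.sum_univ_three] at h0 h1 h2
  intro i
  fin_cases i <;> assumption

lemma finrank_A145 : Module.finrank ℝ A145 = 3 := by
  refine finrank_span_triple (Fintype.linearIndependent_iff.2 fun g hg => ?_)
  have h0 := congrFun hg 0
  have h3 := congrFun hg 3
  have h4 := congrFun hg 4
  simp [Fin.sum_univ_three] at h0 h3 h4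
  intro i
  fin_cases i <;> assumption

lemma finrank_A167 : Module.finrank ℝ A167 = 3 := by
  refine finrank_span_triple (Fintype.linearIndependent_iff.2 fun g hg => ?_)
  have h0 := congrFun hg 0
  have h5 := congrFun hg 5
  have h6 := congrFun hg 6
  simp [Fin.sum_univ_three] at h0 h5 h6
  intro i
  fin_cases i <;> assumption

lemma phi0_eq_zero_of_one_two {u v w : Fin 7 → ℝ} (hu0 : u 0 = 0) (hv0 : v 0 = 0)
    (hw0 : w 0 = 0) (hu : u 1 = 0 ∧ u 2 = 0) (hv : v 1 = 0 ∧ v 2 = 0)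
    (hw : w 1 = 0 ∧ w 2 = 0) : phi0 u v w = 0 := by
  simp [phi0, triD, Matrix.det_fin_three, hu0, hv0, hw0, hu, hv, hw]

lemma phi0_eq_zero_of_three_four {u v w : Fin 7 → ℝ} (hu0 : u 0 = 0) (hv0 : v 0 = 0)
    (hw0 : w 0 = 0) (hu : u 3 = 0 ∧ u 4 = 0) (hv : v 3 = 0 ∧ v 4 = 0)
    (hw : w 3 = 0 ∧ w 4 = 0) : phi0 u v w = 0 := by
  simp [phi0, triD, Matrix.det_fin_three, hu0, hv0, hw0, hu, hv, hw]

/-- A 3-dimensional associative subspace of `H₃` invariant under the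
substitution action of `R_{π/3}` equals one of `A₁₂₃`, `A₁₄₅`, `A₁₆₇`. -/
theorem stmt11 (E : Submodule ℝ (Fin 7 → ℝ)) (hdim : Module.finrank ℝ E = 3)
    (hassoc : IsAssocSubspace E) (hinv : InvUnder (Rmat (Real.pi / 3)) E) :
    E = A123 ∨ E = A145 ∨ E = A167 := by
  have hE : ∀ v ∈ E, rotCoord v ∈ E := fun v hv => rotCoord_mem hinv hv
  obtain ⟨u, v, w, hu, hv, hw, -, -, -, -, -, -, -, hphi⟩ := hassoc
  have hphi0 : phi0 u v w ≠ 0 := by rcases hphi with h | h <;> rw [h] <;> norm_num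
  rcases zero_dichotomy hE with h0 | h0
  · rcases one_two_dichotomy hE with ⟨h1, h2⟩ | h12
    · left
      refine (Submodule.eq_of_le_of_finrank_eq ?_ (finrank_A123.trans hdim.symm)).symm
      rw [A123, Submodule.span_le]
      rintro _ (rfl | rfl | rfl) <;> assumption
    rcases three_four_dichotomy hE with ⟨h3, h4⟩ | h34
    · right; left
      refine (Submodule.eq_of_le_of_finrank_eq ?_ (finrank_A145.trans hdim.symm)).symm
      rw [A145, Submodule.span_le]
      rintro _ (rfl | rfl | rfl) <;> assumption
    · right; right
      refine Submodule.eq_of_le_of_finrank_eq (fun x hx => ?_) (hdim.trans finrank_A167.symm)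
      rw [A167, Submodule.mem_span_triple]
      refine ⟨x 0, x 5, x 6, ?_⟩
      ext i
      fin_cases i <;> simp [h12 x hx, h34 x hx]
  · exfalso
    rcases one_two_dichotomy hE with ⟨h1, h2⟩ | h12
    · rcases three_four_dichotomy hE with ⟨h3, h4⟩ | h34
      · have hli : LinearIndependent ℝ (![⟨_, h1⟩, ⟨_, h2⟩, ⟨_, h3⟩, ⟨_, h4⟩] : Fin 4 → E) := by
          refine Fintype.linearIndependent_iff.2 fun g hg => ?_
          have hg' := congrArg Subtype.val hg
          have e1 := congrFun hg' 1
          have e2 := congrFun hg' 2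
          have e3 := congrFun hg' 3
          have e4 := congrFun hg' 4
          simp [Fin.sum_univ_four] at e1 e2 e3 e4
          intro i
          fin_cases i <;> assumption
        have hcard := hli.fintype_card_le_finrank
        rw [hdim, Fintype.card_fin] at hcard
        omega
      · exact hphi0 (phi0_eq_zero_of_three_four (h0 u hu) (h0 v hv) (h0 w hw)
          (h34 u hu) (h34 v hv) (h34 w hw))
    · exact hphi0 (phi0_eq_zero_of_one_two (h0 u hu) (h0 v hv) (h0 w hw)
        (h12 u hu) (h12 v hv) (h12 w hw))
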